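/- arXiv:2206.03747 — 2 statements merged into one kernel-verified Lean document; each statement's English description precedes it below -/
import Mathlib

section
/- Let a, b > 0 and θ ∈ (0,π) with cos θ ≠ 0. Let M₁ and M₂ be two points of the ellipse E(a,b), and for i = 1, 2 suppose cᵢ ∈ ℝ² and symmetric positive-definite matrices Qᵢ are such that every chord NL of E(a,b) subtending angle θ at Mᵢ is tangent to E(cᵢ,Qᵢ). Then det Q₁ = det Q₂; that is, the two Frégier ellipses have equal area even though their axes lengths may differ. -/
open EuclideanGeometry

noncomputable section

/-- Points of the Euclidean plane. -/
abbrev Pt := EuclideanSpace ℝ (Fin 2)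

/-- The ellipse with semi-axes `a`, `b`, centered at the origin. -/
def ellipseE (a b : ℝ) : Set Pt := {p | p 0 ^ 2 / a ^ 2 + p 1 ^ 2 / b ^ 2 = 1}

/-- The ellipse `{p : (p−c)ᵀ Q (p−c) = 1}` with center `c` and positive-definite
symmetric matrix `Q`. -/
def ellipseQ (c : Pt) (Q : Matrix (Fin 2) (Fin 2) ℝ) : Set Pt :=
  {p | ∑ i, ∑ j, (p i - c i) * Q i j * (p j - c j) = 1}

/-- The line (affine span) through two points. -/
def lineThrough (P Q : Pt) : Set Pt := (affineSpan ℝ {P, Q} : Set Pt)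

/-- A line is tangent to a set if they meet in exactly one point. -/
def IsTangentTo (l S : Set Pt) : Prop := ∃! p, p ∈ l ∩ S

/-- `l` is a line of the plane (the affine span of two distinct points). -/
def IsLine (l : Set Pt) : Prop := ∃ P Q : Pt, P ≠ Q ∧ l = lineThrough P Q

open Real Matrix

/-- If the quadratic form `G` vanishes on the image under `T` of the conic
`(cos t, sin t, 1)`, then `TᵀGT` is a multiple of `diag(1, 1, -1)`. -/
lemma exists_congr_diagonal (G T : Matrix (Fin 3) (Fin 3) ℝ) (hG : G.IsSymm)
    (h : ∀ t : ℝ, (T *ᵥ ![cos t, sin t, 1]) ⬝ᵥ (G *ᵥ (T *ᵥ ![cos t, sin t, 1])) = 0) :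
    ∃ l : ℝ, Tᵀ * G * T = !![l, 0, 0; 0, l, 0; 0, 0, -l] := by
  set H := Tᵀ * G * T with hH
  have hs : H.IsSymm := by
    simp only [hH, Matrix.IsSymm, Matrix.transpose_mul, Matrix.transpose_transpose, hG.eq,
      Matrix.mul_assoc]
  have h' : ∀ t : ℝ, ![cos t, sin t, 1] ⬝ᵥ (H *ᵥ ![cos t, sin t, 1]) = 0 := by
    intro t
    rw [← h t, hH, Matrix.mul_assoc, ← Matrix.mulVec_mulVec, ← Matrix.mulVec_mulVec,
      Matrix.dotProduct_mulVec, Matrix.vecMul_transpose]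
  have e01 : H 1 0 = H 0 1 := hs.apply 0 1
  have e02 : H 2 0 = H 0 2 := hs.apply 0 2
  have e12 : H 2 1 = H 1 2 := hs.apply 1 2
  simp only [dotProduct, mulVec, Fin.sum_univ_three, Matrix.cons_val, e01, e02, e12] at h'
  have h1 := h' 0
  have h2 := h' π
  have h3 := h' (π / 2)
  have h4 := h' (-(π / 2))
  have h5 := h' (π / 4)
  have h6 := h' (-(π / 4))
  simp only [cos_zero, sin_zero, cos_pi, sin_pi, cos_pi_div_two, sin_pi_div_two, cos_neg,
    sin_neg, cos_pi_div_four, sin_pi_div_four] at h1 h2 h3 h4 h5 h6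
  have k02 : H 0 2 = 0 := by linarith
  have k12 : H 1 2 = 0 := by linarith
  have k01 : H 0 1 = 0 := by
    have := Real.sq_sqrt (show (0 : ℝ) ≤ 2 by norm_num)
    rw [k02, k12] at h5 h6
    linear_combination (h5 - h6) / 2 - H 0 1 / 2 * this
  refine ⟨H 0 0, ?_⟩
  ext i j
  fin_cases i <;> fin_cases j <;> simp [e01, e02, e12, k02, k12, k01] <;> linarith

/-- The last entry of a quadratic form `G` with `det G = G₂₂²` vanishing on the image under `T`
of the conic `(cos t, sin t, 1)` is determined by `T`. -/
lemma entry_mul_det_pow (G T : Matrix (Fin 3) (Fin 3) ℝ) (hG : G.IsSymm)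
    (hdet : G.det = G 2 2 ^ 2) (hG0 : G 2 2 ≠ 0) (hT : T.det ≠ 0)
    (h : ∀ t : ℝ, (T *ᵥ ![cos t, sin t, 1]) ⬝ᵥ (G *ᵥ (T *ᵥ ![cos t, sin t, 1])) = 0) :
    G 2 2 * T.det ^ 4 =
      -(T.adjugate 0 2 ^ 2 + T.adjugate 1 2 ^ 2 - T.adjugate 2 2 ^ 2) ^ 3 := by
  obtain ⟨l, hl⟩ := exists_congr_diagonal G T hG h
  have h1 : T.det ^ 2 * G 2 2 ^ 2 = -l ^ 3 := by
    have := congrArg Matrix.det hl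
    rw [det_mul, det_mul, det_transpose, hdet] at this
    rw [show T.det ^ 2 * G 2 2 ^ 2 = T.det * G 2 2 ^ 2 * T.det by ring, this, det_fin_three]
    simp
    ring
  have h2 : T.det ^ 2 * G 2 2 =
      l * (T.adjugate 0 2 ^ 2 + T.adjugate 1 2 ^ 2 - T.adjugate 2 2 ^ 2) := by
    have e : T.adjugateᵀ * (Tᵀ * G * T) * T.adjugate = T.det ^ 2 • G := by
      have : T.adjugateᵀ * (Tᵀ * G * T) * T.adjugate =
          (T * T.adjugate)ᵀ * G * (T * T.adjugate) := by
        simp only [transpose_mul, Matrix.mul_assoc]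
      rw [this, mul_adjugate]
      simp [smul_smul, sq]
    have := congrFun (congrFun e 2) 2
    rw [hl] at this
    simp only [Matrix.mul_apply, Fin.sum_univ_three, Matrix.smul_apply, smul_eq_mul,
      transpose_apply, of_apply, Matrix.cons_val] at this
    rw [← this]
    ring
  have h3 : T.det ^ 2 * G 2 2 ^ 2 ≠ 0 := by positivity
  apply mul_left_cancel₀ h3
  set q := T.adjugate 0 2 ^ 2 + T.adjugate 1 2 ^ 2 - T.adjugate 2 2 ^ 2
  calc T.det ^ 2 * G 2 2 ^ 2 * (G 2 2 * T.det ^ 4) = (T.det ^ 2 * G 2 2) ^ 3 := by ring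
    _ = (l * q) ^ 3 := by rw [h2]
    _ = T.det ^ 2 * G 2 2 ^ 2 * -q ^ 3 := by rw [h1]; ring

/-- The tangency condition for the line through `N` and `L` with respect to an ellipse. -/
lemma IsTangentTo.quadForm_eq {N L c : Pt} {Q : Matrix (Fin 2) (Fin 2) ℝ} (hs : Q.IsSymm)
    (hp : Q.PosDef) (hNL : N ≠ L) (h : IsTangentTo (lineThrough N L) (ellipseQ c Q)) :
    Q 0 0 * (L 0 - N 0) ^ 2 + 2 * Q 0 1 * (L 0 - N 0) * (L 1 - N 1) + Q 1 1 * (L 1 - N 1) ^ 2 =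
      Q.det * ((L 0 - N 0) * (N 1 - c 1) - (L 1 - N 1) * (N 0 - c 0)) ^ 2 := by
  have e01 : Q 1 0 = Q 0 1 := hs.apply 0 1
  have hA : 0 < Q 0 0 * (L 0 - N 0) ^ 2 + 2 * Q 0 1 * (L 0 - N 0) * (L 1 - N 1)
      + Q 1 1 * (L 1 - N 1) ^ 2 := by
    have hne : ![L 0 - N 0, L 1 - N 1] ≠ 0 := by
      intro h0
      apply hNL
      ext i
      have := congrFun h0 i
      fin_cases i <;> simp at this ⊢ <;> linarith
    have := hp.dotProduct_mulVec_pos hne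
    simp [dotProduct, mulVec, Fin.sum_univ_two, e01] at this
    linarith
  set A := Q 0 0 * (L 0 - N 0) ^ 2 + 2 * Q 0 1 * (L 0 - N 0) * (L 1 - N 1)
      + Q 1 1 * (L 1 - N 1) ^ 2 with hAdef
  set B := Q 0 0 * (L 0 - N 0) * (N 0 - c 0) + Q 0 1 * ((L 0 - N 0) * (N 1 - c 1)
    + (L 1 - N 1) * (N 0 - c 0)) + Q 1 1 * (L 1 - N 1) * (N 1 - c 1) with hB
  set C := Q 0 0 * (N 0 - c 0) ^ 2 + 2 * Q 0 1 * (N 0 - c 0) * (N 1 - c 1)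
      + Q 1 1 * (N 1 - c 1) ^ 2 - 1 with hC
  have key : ∀ t : ℝ, AffineMap.lineMap N L t ∈ ellipseQ c Q ↔ A * t ^ 2 + 2 * B * t + C = 0 := by
    intro t
    simp only [ellipseQ, Set.mem_ofPred_eq, Fin.sum_univ_two, e01, AffineMap.lineMap_apply,
      vsub_eq_sub, vadd_eq_add, PiLp.add_apply, PiLp.smul_apply, PiLp.sub_apply, smul_eq_mul]
    rw [← sub_eq_zero]
    apply Eq.congr_left
    rw [hAdef, hB, hC]
    ring
  obtain ⟨p, ⟨hp1, hp2⟩, huniq⟩ := h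
  obtain ⟨t, rfl⟩ := mem_affineSpan_pair_iff_exists_lineMap_eq.1 hp1
  have ht := (key t).1 hp2
  have ht' : AffineMap.lineMap N L (-2 * B / A - t) ∈ ellipseQ c Q := by
    rw [key]
    field_simp
    linear_combination A * ht
  have heq := AffineMap.lineMap_injective ℝ hNL
    (huniq _ ⟨AffineMap.lineMap_mem_affineSpan_pair _ _ _, ht'⟩)
  have hBt : B = -A * t := by
    field_simp at heq
    linarith
  have hdisc : B ^ 2 - A * C = 0 := by
    rw [hBt] at ht ⊢
    linear_combination -A * ht
  rw [det_fin_two, e01]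
  have : B ^ 2 - A * C = A - (Q 0 0 * Q 1 1 - Q 0 1 * Q 0 1) *
      ((L 0 - N 0) * (N 1 - c 1) - (L 1 - N 1) * (N 0 - c 0)) ^ 2 := by
    rw [hAdef, hB, hC]
    ring
  linarith

/-- The unit vector in direction `φ`. -/
def unitVec (φ : ℝ) : Pt := !₂[cos φ, sin φ]

lemma angle_unitVec {φ θ : ℝ} (h : θ ∈ Set.Ioo 0 π) :
    InnerProductGeometry.angle (unitVec φ) (unitVec (φ + θ)) = θ := by
  have hn : ∀ x, ‖unitVec x‖ = 1 := by
    intro x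
    simp [unitVec, EuclideanSpace.norm_eq, Fin.sum_univ_two]
  rw [InnerProductGeometry.angle, hn, hn]
  have : inner ℝ (unitVec φ) (unitVec (φ + θ)) = cos θ := by
    simp only [unitVec, PiLp.inner_apply, Fin.sum_univ_two]
    have := cos_sub (φ + θ) φ
    simp at this ⊢
    linarith
  rw [this]
  simp [arccos_cos h.1.le h.2.le]

/-- The point where the ray from `M` in direction `φ` meets the ellipse again. -/
def secondPoint (a b : ℝ) (M : Pt) (φ : ℝ) : Pt :=
  M + (2 * -(M 0 / a ^ 2 * cos φ + M 1 / b ^ 2 * sin φ) /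
    (cos φ ^ 2 / a ^ 2 + sin φ ^ 2 / b ^ 2)) • unitVec φ

lemma dirForm_pos {a b : ℝ} (ha : 0 < a) (hb : 0 < b) (φ : ℝ) :
    0 < cos φ ^ 2 / a ^ 2 + sin φ ^ 2 / b ^ 2 := by
  have h := sin_sq_add_cos_sq φ
  rcases eq_or_ne (cos φ) 0 with h0 | h0
  · have : sin φ ≠ 0 := by
      intro h1
      simp [h0, h1] at h
    positivity
  · positivity

lemma secondPoint_mem {a b : ℝ} (ha : 0 < a) (hb : 0 < b) {M : Pt} (hM : M ∈ ellipseE a b)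
    (φ : ℝ) : secondPoint a b M φ ∈ ellipseE a b := by
  have hk := (dirForm_pos ha hb φ).ne'
  simp only [ellipseE, Set.mem_ofPred_eq] at hM ⊢
  simp only [secondPoint, unitVec, PiLp.add_apply, PiLp.smul_apply, smul_eq_mul,
    Matrix.cons_val]
  set g := M 0 / a ^ 2 * cos φ + M 1 / b ^ 2 * sin φ with hg
  set k := cos φ ^ 2 / a ^ 2 + sin φ ^ 2 / b ^ 2 with hkdef
  have : ∀ r : ℝ, (M 0 + r * cos φ) ^ 2 / a ^ 2 + (M 1 + r * sin φ) ^ 2 / b ^ 2 =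
      M 0 ^ 2 / a ^ 2 + M 1 ^ 2 / b ^ 2 + r * (2 * g + r * k) := by
    intro r
    rw [hg, hkdef]
    ring
  rw [this, hM]
  field_simp
  ring

/-- The tangency condition for the chord subtending the angle `θ` at `M` whose endpoints lie in
the directions `φ` and `φ + θ`. -/
lemma chord_condition {a b θ : ℝ} (ha : 0 < a) (hb : 0 < b) (hθ : θ ∈ Set.Ioo 0 π) {M : Pt}
    (hM : M ∈ ellipseE a b) {c : Pt} {Q : Matrix (Fin 2) (Fin 2) ℝ}
    (hs : Q.IsSymm) (hp : Q.PosDef)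
    (hEnv : ∀ N L : Pt, N ∈ ellipseE a b → L ∈ ellipseE a b →
      M ≠ N → M ≠ L → N ≠ L → EuclideanGeometry.angle N M L = θ →
      IsTangentTo (lineThrough N L) (ellipseQ c Q))
    {φ k₁ k₂ g₁ g₂ v₀ v₁ : ℝ}
    (hk₁ : k₁ = cos φ ^ 2 / a ^ 2 + sin φ ^ 2 / b ^ 2)
    (hk₂ : k₂ = cos (φ + θ) ^ 2 / a ^ 2 + sin (φ + θ) ^ 2 / b ^ 2)
    (hg₁ : g₁ = -(M 0 / a ^ 2 * cos φ + M 1 / b ^ 2 * sin φ))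
    (hg₂ : g₂ = -(M 0 / a ^ 2 * cos (φ + θ) + M 1 / b ^ 2 * sin (φ + θ)))
    (hv₀ : v₀ = k₁ * g₂ * cos (φ + θ) - k₂ * g₁ * cos φ)
    (hv₁ : v₁ = k₁ * g₂ * sin (φ + θ) - k₂ * g₁ * sin φ)
    (h₁ : 0 < g₁) (h₂ : 0 < g₂) :
    Q 0 0 * v₀ ^ 2 + 2 * Q 0 1 * v₀ * v₁ + Q 1 1 * v₁ ^ 2 =
      Q.det * (2 * g₁ * g₂ * sin θ - (v₀ * (M 1 - c 1) - v₁ * (M 0 - c 0))) ^ 2 := by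
  have p₁ : 0 < k₁ := hk₁ ▸ dirForm_pos ha hb φ
  have p₂ : 0 < k₂ := hk₂ ▸ dirForm_pos ha hb (φ + θ)
  have r₁ : 0 < 2 * g₁ / k₁ := by positivity
  have r₂ : 0 < 2 * g₂ / k₂ := by positivity
  have hN : secondPoint a b M φ = M + (2 * g₁ / k₁) • unitVec φ := by
    rw [secondPoint, hg₁, hk₁]
  have hL : secondPoint a b M (φ + θ) = M + (2 * g₂ / k₂) • unitVec (φ + θ) := by
    rw [secondPoint, hg₂, hk₂]
  have hang : EuclideanGeometry.angle (secondPoint a b M φ) M (secondPoint a b M (φ + θ)) = θ := by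
    rw [EuclideanGeometry.angle, hN, hL, vsub_eq_sub, vsub_eq_sub, add_sub_cancel_left,
      add_sub_cancel_left, InnerProductGeometry.angle_smul_left_of_pos _ _ r₁,
      InnerProductGeometry.angle_smul_right_of_pos _ _ r₂, angle_unitVec hθ]
  have hu : ∀ x, unitVec x ≠ 0 := by
    intro x h0
    have e0 := congrArg (fun p : Pt => p 0) h0
    have e1 := congrArg (fun p : Pt => p 1) h0
    simp [unitVec] at e0 e1
    have := sin_sq_add_cos_sq x
    simp [e0, e1] at this
  have hMN : M ≠ secondPoint a b M φ := by
    rw [hN, ne_comm, ne_eq, add_eq_left]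
    exact smul_ne_zero r₁.ne' (hu _)
  have hML : M ≠ secondPoint a b M (φ + θ) := by
    rw [hL, ne_comm, ne_eq, add_eq_left]
    exact smul_ne_zero r₂.ne' (hu _)
  have hNL : secondPoint a b M φ ≠ secondPoint a b M (φ + θ) := by
    intro h
    rw [← h, EuclideanGeometry.angle_self_of_ne hMN.symm] at hang
    exact hθ.1.ne hang
  have key := (hEnv _ _ (secondPoint_mem ha hb hM φ) (secondPoint_mem ha hb hM (φ + θ))
    hMN hML hNL hang).quadForm_eq hs hp hNL
  rw [hN, hL] at key
  simp only [unitVec, PiLp.add_apply, PiLp.smul_apply, smul_eq_mul,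
    Matrix.cons_val] at key
  have d₀ : M 0 + 2 * g₂ / k₂ * cos (φ + θ) - (M 0 + 2 * g₁ / k₁ * cos φ) =
      2 / (k₁ * k₂) * v₀ := by
    rw [hv₀]
    field_simp
    ring
  have d₁ : M 1 + 2 * g₂ / k₂ * sin (φ + θ) - (M 1 + 2 * g₁ / k₁ * sin φ) =
      2 / (k₁ * k₂) * v₁ := by
    rw [hv₁]
    field_simp
    ring
  have hsin : sin θ = sin (φ + θ) * cos φ - cos (φ + θ) * sin φ := by
    rw [← sin_sub, add_sub_cancel_left]
  have hw : v₀ * (M 1 + 2 * g₁ / k₁ * sin φ - c 1) - v₁ * (M 0 + 2 * g₁ / k₁ * cos φ - c 0) =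
      -(2 * g₁ * g₂ * sin θ - (v₀ * (M 1 - c 1) - v₁ * (M 0 - c 0))) := by
    rw [hsin, hv₀, hv₁]
    field_simp
    ring
  rw [d₀, d₁] at key
  have hm : (2 / (k₁ * k₂)) ^ 2 ≠ 0 := by positivity
  apply mul_left_cancel₀ hm
  rw [← neg_sq (2 * g₁ * g₂ * sin θ - _), ← hw]
  linear_combination key

/-- The linear parametrization, by the doubled direction of the bisector, of the chords
subtending at `M` an angle with cosine `k`. Here `A = a⁻²`, `B = b⁻²` and `(α, β)` is half the
gradient at `M`. -/
def chordMatrix (A B α β k : ℝ) : Matrix (Fin 3) (Fin 3) ℝ :=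
  !![-(A + B) / 2 * β, B * α, k * (B - A) / 2 * β;
    -(A + B) / 2 * α, -A * β, k * (B - A) / 2 * α;
    α ^ 2 - β ^ 2, 2 * α * β, k * (α ^ 2 + β ^ 2)]

/-- The quadratic form on line coordinates expressing tangency to an ellipse with matrix `Q` and
center `c`, where `(m, n) = M - c` and lines are given relative to `M`. -/
def dualForm (Q : Matrix (Fin 2) (Fin 2) ℝ) (m n : ℝ) : Matrix (Fin 3) (Fin 3) ℝ :=
  !![Q.det * n ^ 2 - Q 0 0, -Q.det * m * n - Q 0 1, -Q.det * n;
    -Q.det * m * n - Q 0 1, Q.det * m ^ 2 - Q 1 1, Q.det * m;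
    -Q.det * n, Q.det * m, Q.det]

lemma dualForm_apply (Q : Matrix (Fin 2) (Fin 2) ℝ) (m n : ℝ) (u : Fin 3 → ℝ) :
    u ⬝ᵥ (dualForm Q m n *ᵥ u) = Q.det * (u 2 - (u 0 * n - u 1 * m)) ^ 2 -
      (Q 0 0 * u 0 ^ 2 + 2 * Q 0 1 * u 0 * u 1 + Q 1 1 * u 1 ^ 2) := by
  simp only [dualForm, dotProduct, mulVec, Fin.sum_univ_three, of_apply, Matrix.cons_val]
  ring

lemma det_dualForm {Q : Matrix (Fin 2) (Fin 2) ℝ} (hs : Q.IsSymm) (m n : ℝ) :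
    (dualForm Q m n).det = dualForm Q m n 2 2 ^ 2 := by
  have e01 : Q 1 0 = Q 0 1 := hs.apply 0 1
  simp only [dualForm, det_fin_three, det_fin_two, of_apply, Matrix.cons_val, e01]
  ring

lemma dualForm_isSymm (Q : Matrix (Fin 2) (Fin 2) ℝ) (m n : ℝ) : (dualForm Q m n).IsSymm := by
  ext i j
  fin_cases i <;> fin_cases j <;> rfl

lemma det_chordMatrix {A B α β k : ℝ} (h : B * α ^ 2 + A * β ^ 2 = A * B) :
    (chordMatrix A B α β k).det = k * (A * B) ^ 2 := by
  simp only [chordMatrix, det_fin_three, of_apply, Matrix.cons_val]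
  linear_combination k * (B * α ^ 2 + A * β ^ 2 + A * B) * h

lemma adjugate_chordMatrix {A B α β k : ℝ} (h : B * α ^ 2 + A * β ^ 2 = A * B) :
    (chordMatrix A B α β k).adjugate 0 2 = k * (B - A) * (A * B) / 2 ∧
    (chordMatrix A B α β k).adjugate 1 2 = 0 ∧
    (chordMatrix A B α β k).adjugate 2 2 = (A + B) * (A * B) / 2 := by
  simp only [chordMatrix, adjugate_fin_three_of, of_apply, Matrix.cons_val]
  refine ⟨?_, ?_, ?_⟩
  · linear_combination k * (B - A) / 2 * h
  · ring
  · linear_combination (A + B) / 2 * h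

/-- The chord joining the second intersections in directions `ψ - h`, `ψ + h` in terms of
`chordMatrix`. -/
lemma chordMatrix_mulVec (A B α β ψ h : ℝ) (v : Fin 3 → ℝ)
    (hv : v = chordMatrix A B α β (cos (2 * h)) *ᵥ ![cos (2 * ψ), sin (2 * ψ), 1])
    {k₁ k₂ g₁ g₂ : ℝ}
    (hk₁ : k₁ = cos (ψ - h) ^ 2 * A + sin (ψ - h) ^ 2 * B)
    (hk₂ : k₂ = cos (ψ + h) ^ 2 * A + sin (ψ + h) ^ 2 * B)
    (hg₁ : g₁ = -(α * cos (ψ - h) + β * sin (ψ - h)))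
    (hg₂ : g₂ = -(α * cos (ψ + h) + β * sin (ψ + h))) :
    k₁ * g₂ * cos (ψ + h) - k₂ * g₁ * cos (ψ - h) = sin (2 * h) * v 0 ∧
    k₁ * g₂ * sin (ψ + h) - k₂ * g₁ * sin (ψ - h) = sin (2 * h) * v 1 ∧
    2 * g₁ * g₂ = v 2 := by
  subst hv hk₁ hk₂ hg₁ hg₂
  simp only [chordMatrix, mulVec, dotProduct, Fin.sum_univ_three, of_apply, Matrix.cons_val]
  simp only [cos_add, cos_sub, sin_add, sin_sub, cos_two_mul', sin_two_mul]
  have e1 := cos_sq_add_sin_sq ψ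
  have e2 := cos_sq_add_sin_sq h
  set x := cos ψ
  set y := sin ψ
  set C := cos h
  set S := sin h
  refine ⟨?_, ?_, ?_⟩
  · trans 2 * S * C * ((-(A + B) / 2 * β * (x ^ 2 - y ^ 2) + B * α * (2 * y * x)) *
      (x ^ 2 + y ^ 2) * (C ^ 2 + S ^ 2) +
        (C ^ 2 - S ^ 2) * (B - A) / 2 * β * (x ^ 2 + y ^ 2) ^ 2)
    · ring
    · rw [e1, e2]
      ring
  · trans 2 * S * C * ((-(A + B) / 2 * α * (x ^ 2 - y ^ 2) - A * β * (2 * y * x)) *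
      (x ^ 2 + y ^ 2) * (C ^ 2 + S ^ 2) +
        (C ^ 2 - S ^ 2) * (B - A) / 2 * α * (x ^ 2 + y ^ 2) ^ 2)
    · ring
    · rw [e1, e2]
      ring
  · trans ((α ^ 2 - β ^ 2) * (x ^ 2 - y ^ 2) + 2 * α * β * (2 * y * x)) * (C ^ 2 + S ^ 2) +
        (C ^ 2 - S ^ 2) * (α ^ 2 + β ^ 2) * (x ^ 2 + y ^ 2)
    · ring
    · rw [e1, e2]
      ring

lemma fregier_det_mul {a b θ : ℝ} (ha : 0 < a) (hb : 0 < b) (hθ : θ ∈ Set.Ioo 0 π)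
    (hcos : cos θ ≠ 0) {M : Pt}
    (hM : M ∈ ellipseE a b) {c : Pt} {Q : Matrix (Fin 2) (Fin 2) ℝ}
    (hs : Q.IsSymm) (hp : Q.PosDef)
    (hEnv : ∀ N L : Pt, N ∈ ellipseE a b → L ∈ ellipseE a b →
      M ≠ N → M ≠ L → N ≠ L → EuclideanGeometry.angle N M L = θ →
      IsTangentTo (lineThrough N L) (ellipseQ c Q)) :
    Q.det * (cos θ * ((a ^ 2)⁻¹ * (b ^ 2)⁻¹) ^ 2) ^ 4 =
      -((cos θ * ((b ^ 2)⁻¹ - (a ^ 2)⁻¹) * ((a ^ 2)⁻¹ * (b ^ 2)⁻¹) / 2) ^ 2 + 0 ^ 2 -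
        (((a ^ 2)⁻¹ + (b ^ 2)⁻¹) * ((a ^ 2)⁻¹ * (b ^ 2)⁻¹) / 2) ^ 2) ^ 3 := by
  set A := (a ^ 2)⁻¹ with hA
  set B := (b ^ 2)⁻¹ with hB
  have hA0 : 0 < A := by positivity
  have hB0 : 0 < B := by positivity
  set α := M 0 / a ^ 2 with hα
  set β := M 1 / b ^ 2 with hβ
  have hn : B * α ^ 2 + A * β ^ 2 = A * B := by
    have : M 0 ^ 2 / a ^ 2 + M 1 ^ 2 / b ^ 2 = 1 := hM
    rw [hα, hβ, hA, hB]
    field_simp at this ⊢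
    linarith
  set T := chordMatrix A B α β (cos θ) with hT
  set G := dualForm Q (M 0 - c 0) (M 1 - c 1) with hG
  have hsin : 0 < sin θ := sin_pos_of_pos_of_lt_pi hθ.1 hθ.2
  set F : ℝ → ℝ := fun t =>
    (T *ᵥ ![cos t, sin t, 1]) ⬝ᵥ (G *ᵥ (T *ᵥ ![cos t, sin t, 1])) with hF
  obtain ⟨ψ₀, hψ₁, hψ₂⟩ : ∃ ψ₀ : ℝ, 0 < -(α * cos (ψ₀ - θ / 2) + β * sin (ψ₀ - θ / 2)) ∧
      0 < -(α * cos (ψ₀ + θ / 2) + β * sin (ψ₀ + θ / 2)) := by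
    set z : ℂ := ⟨-α, -β⟩ with hz
    have hz0 : z ≠ 0 := by
      intro h0
      have e1 := congrArg Complex.re h0
      have e2 := congrArg Complex.im h0
      simp only [hz, Complex.zero_re, Complex.zero_im, neg_eq_zero] at e1 e2
      rw [e1, e2] at hn
      have : 0 < A * B := by positivity
      simp at hn
      rcases hn with h | h <;> simp [h] at this
    have hr : 0 < ‖z‖ := norm_pos_iff.2 hz0
    have c1 : ‖z‖ * cos z.arg = -α := Complex.norm_mul_cos_arg z
    have c2 : ‖z‖ * sin z.arg = -β := Complex.norm_mul_sin_arg z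
    have hc : 0 < cos (θ / 2) := cos_pos_of_mem_Ioo ⟨by linarith [hθ.1, pi_pos], by linarith [hθ.2]⟩
    have e := cos_sq_add_sin_sq z.arg
    refine ⟨z.arg, ?_, ?_⟩
    · have : -(α * cos (z.arg - θ / 2) + β * sin (z.arg - θ / 2)) = ‖z‖ * cos (θ / 2) := by
        rw [cos_sub, sin_sub]
        linear_combination (-(cos z.arg * cos (θ / 2) + sin z.arg * sin (θ / 2))) * c1
          - (sin z.arg * cos (θ / 2) - cos z.arg * sin (θ / 2)) * c2 + ‖z‖ * cos (θ / 2) * e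
      rw [this]
      positivity
    · have : -(α * cos (z.arg + θ / 2) + β * sin (z.arg + θ / 2)) = ‖z‖ * cos (θ / 2) := by
        rw [cos_add, sin_add]
        linear_combination (-(cos z.arg * cos (θ / 2) - sin z.arg * sin (θ / 2))) * c1
          - (sin z.arg * cos (θ / 2) + cos z.arg * sin (θ / 2)) * c2 + ‖z‖ * cos (θ / 2) * e
      rw [this]
      positivity
  have hlocal : ∀ ψ : ℝ, 0 < -(α * cos (ψ - θ / 2) + β * sin (ψ - θ / 2)) →
      0 < -(α * cos (ψ + θ / 2) + β * sin (ψ + θ / 2)) → F (2 * ψ) = 0 := by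
    intro ψ h₁ h₂
    have hθ2 : 2 * (θ / 2) = θ := by ring
    have hψ : ψ - θ / 2 + θ = ψ + θ / 2 := by ring
    obtain ⟨m₀, m₁, m₂⟩ := chordMatrix_mulVec A B α β ψ (θ / 2) _ rfl rfl rfl rfl rfl
    rw [hθ2, ← hT] at m₀ m₁ m₂
    have key := chord_condition ha hb hθ hM hs hp hEnv (φ := ψ - θ / 2) rfl rfl rfl rfl rfl rfl
      h₁ (by rw [hψ]; exact h₂)
    rw [hψ] at key
    simp only [div_eq_mul_inv _ (a ^ 2), div_eq_mul_inv _ (b ^ 2)] at key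
    simp only [hα, hβ, div_eq_mul_inv _ (a ^ 2), div_eq_mul_inv _ (b ^ 2)] at m₀ m₁ m₂
    rw [m₀, m₁, m₂] at key
    have hs2 : sin θ ^ 2 ≠ 0 := by positivity
    apply mul_left_cancel₀ hs2
    rw [hF]
    simp only [hG, dualForm_apply]
    linear_combination -key
  have hFan : AnalyticOnNhd ℝ F Set.univ := by
    rw [hF]
    simp only [dotProduct, mulVec, Fin.sum_univ_three, Matrix.cons_val]
    intro x _
    fun_prop
  have hFzero : ∀ t, F t = 0 := by
    have hev : ∀ᶠ t in nhds (2 * ψ₀), F t = 0 := by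
      have c1 : ContinuousAt (fun t : ℝ => -(α * cos (t / 2 - θ / 2) + β * sin (t / 2 - θ / 2)))
        (2 * ψ₀) := by fun_prop
      have c2 : ContinuousAt (fun t : ℝ => -(α * cos (t / 2 + θ / 2) + β * sin (t / 2 + θ / 2)))
        (2 * ψ₀) := by fun_prop
      have e : 2 * ψ₀ / 2 = ψ₀ := by ring
      filter_upwards [c1.eventually_const_lt (u := 0) (by simpa only [e] using hψ₁),
        c2.eventually_const_lt (u := 0) (by simpa only [e] using hψ₂)] with t h1 h2
      have := hlocal (t / 2) h1 h2
      rwa [mul_div_cancel₀ t two_ne_zero] at this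
    intro t
    exact congrFun (hFan.eq_of_eventuallyEq analyticOnNhd_const hev) t
  have hdet0 : Q.det ≠ 0 := hp.det_pos.ne'
  have hTdet : T.det = cos θ * (A * B) ^ 2 := det_chordMatrix hn
  obtain ⟨a0, a1, a2⟩ := adjugate_chordMatrix (k := cos θ) hn
  have := entry_mul_det_pow G T (dualForm_isSymm _ _ _) (det_dualForm hs _ _) hdet0
    (by rw [hTdet]; positivity) hFzero
  rw [hTdet, hT, a0, a1, a2] at this
  exact this

/-- **Area invariance.** Frégier ellipses for the same angle `θ` at two different points
`M₁`, `M₂` of the ellipse `E(a,b)` have the same determinant, hence the same area. -/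
theorem fregier_area_invariant (a b θ : ℝ) (ha : 0 < a) (hb : 0 < b)
    (hθ : θ ∈ Set.Ioo 0 Real.pi) (hcos : Real.cos θ ≠ 0)
    (M₁ M₂ : Pt) (hM₁ : M₁ ∈ ellipseE a b) (hM₂ : M₂ ∈ ellipseE a b)
    (c₁ c₂ : Pt) (Q₁ Q₂ : Matrix (Fin 2) (Fin 2) ℝ)
    (hQ₁s : Q₁.IsSymm) (hQ₁p : Q₁.PosDef) (hQ₂s : Q₂.IsSymm) (hQ₂p : Q₂.PosDef)
    (hEnv₁ : ∀ N L : Pt, N ∈ ellipseE a b → L ∈ ellipseE a b →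
      M₁ ≠ N → M₁ ≠ L → N ≠ L → EuclideanGeometry.angle N M₁ L = θ →
      IsTangentTo (lineThrough N L) (ellipseQ c₁ Q₁))
    (hEnv₂ : ∀ N L : Pt, N ∈ ellipseE a b → L ∈ ellipseE a b →
      M₂ ≠ N → M₂ ≠ L → N ≠ L → EuclideanGeometry.angle N M₂ L = θ →
      IsTangentTo (lineThrough N L) (ellipseQ c₂ Q₂)) :
    Q₁.det = Q₂.det := by
  have h₁ := fregier_det_mul ha hb hθ hcos hM₁ hQ₁s hQ₁p hEnv₁
  have h₂ := fregier_det_mul ha hb hθ hcos hM₂ hQ₂s hQ₂p hEnv₂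
  exact mul_right_cancel₀ (by positivity) (h₁.trans h₂.symm)
end
end

section
/- Let a, b > 0, let M be a point of the ellipse E(a,b), and let θ = π/4. Suppose c ∈ ℝ² and a symmetric positive-definite matrix Q are such that every chord NL of E(a,b) subtending angle π/4 at M is tangent to E(c,Q). If ℓ₁ and ℓ₂ are two distinct lines through M tangent to E(c,Q) at points T₁ and T₂ respectively, then ∠T₁MT₂ = π/2; that is, M lies on the orthoptic circle of the Frégier ellipse E(c,Q). -/
open EuclideanGeometry

noncomputable section

/-- The discriminant, up to a factor `4`, of the restriction of `q - 1` to the line through `d` with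
direction `w`, where `q` is the quadratic form with matrix `!![q₀, q₁; q₁, q₂]`. -/
def tangencyDisc (q₀ q₁ q₂ d₀ d₁ w₀ w₁ : ℝ) : ℝ :=
  (q₀ * d₀ * w₀ + q₁ * (d₀ * w₁ + d₁ * w₀) + q₂ * d₁ * w₁) ^ 2 -
    (q₀ * w₀ ^ 2 + 2 * q₁ * w₀ * w₁ + q₂ * w₁ ^ 2) *
      (q₀ * d₀ ^ 2 + 2 * q₁ * d₀ * d₁ + q₂ * d₁ ^ 2 - 1)

lemma mem_ellipseQ_iff {c : Pt} {Q : Matrix (Fin 2) (Fin 2) ℝ} (hQ : Q.IsSymm) {p : Pt} :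
    p ∈ ellipseQ c Q ↔ Q 0 0 * (p 0 - c 0) ^ 2 + 2 * Q 0 1 * (p 0 - c 0) * (p 1 - c 1) +
      Q 1 1 * (p 1 - c 1) ^ 2 = 1 := by
  have h : Q 1 0 = Q 0 1 := hQ.apply 0 1
  simp only [ellipseQ, Set.mem_ofPred_eq, Fin.sum_univ_two, h]
  ring_nf

lemma posDef_fin_two_form_pos {Q : Matrix (Fin 2) (Fin 2) ℝ} (hQs : Q.IsSymm) (hQ : Q.PosDef)
    {x y : ℝ} (h : x ≠ 0 ∨ y ≠ 0) :
    0 < Q 0 0 * x ^ 2 + 2 * Q 0 1 * x * y + Q 1 1 * y ^ 2 := by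
  have hs : Q 1 0 = Q 0 1 := hQs.apply 0 1
  have hv : ![x, y] ≠ 0 := by
    intro h0
    have h1 := congrFun h0 0
    have h2 := congrFun h0 1
    simp_all
  have := hQ.dotProduct_mulVec_pos hv
  simp [Matrix.mulVec, dotProduct, Fin.sum_univ_two, hs] at this
  linarith

lemma mem_lineThrough_iff {P R p : Pt} :
    p ∈ lineThrough P R ↔ ∃ t : ℝ, p 0 = P 0 + t * (R 0 - P 0) ∧ p 1 = P 1 + t * (R 1 - P 1) := by
  rw [lineThrough, SetLike.mem_coe, mem_affineSpan_pair_iff_exists_lineMap_eq]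
  refine exists_congr fun t => ?_
  constructor
  · rintro rfl
    simp [AffineMap.lineMap_apply]
    constructor <;> ring
  · rintro ⟨h0, h1⟩
    ext i
    fin_cases i <;> simp [AffineMap.lineMap_apply, h0, h1] <;> ring

lemma Pt.ne_iff {P R : Pt} : P ≠ R ↔ R 0 - P 0 ≠ 0 ∨ R 1 - P 1 ≠ 0 := by
  rw [← not_and_or, ne_eq, not_iff_not]
  constructor
  · rintro rfl
    simp
  · rintro ⟨h0, h1⟩
    ext i
    fin_cases i
    · exact (sub_eq_zero.mp h0).symm
    · exact (sub_eq_zero.mp h1).symm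

lemma tangencyDisc_eq_zero {c : Pt} {Q : Matrix (Fin 2) (Fin 2) ℝ} (hQs : Q.IsSymm)
    (hQ : Q.PosDef) {P R : Pt} (hPR : P ≠ R)
    (h : IsTangentTo (lineThrough P R) (ellipseQ c Q)) :
    tangencyDisc (Q 0 0) (Q 0 1) (Q 1 1) (P 0 - c 0) (P 1 - c 1) (R 0 - P 0) (R 1 - P 1) = 0 := by
  obtain ⟨p, ⟨hpl, hpe⟩, huniq⟩ := h
  obtain ⟨t, h0, h1⟩ := mem_lineThrough_iff.mp hpl
  rw [mem_ellipseQ_iff hQs, h0, h1] at hpe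
  have hPR' := Pt.ne_iff.mp hPR
  have hα := posDef_fin_two_form_pos hQs hQ hPR'
  set α := Q 0 0 * (R 0 - P 0) ^ 2 + 2 * Q 0 1 * (R 0 - P 0) * (R 1 - P 1) +
    Q 1 1 * (R 1 - P 1) ^ 2 with hαdef
  set β := Q 0 0 * (P 0 - c 0) * (R 0 - P 0) + Q 0 1 * ((P 0 - c 0) * (R 1 - P 1) +
    (P 1 - c 1) * (R 0 - P 0)) + Q 1 1 * (P 1 - c 1) * (R 1 - P 1) with hβdef
  set γ := Q 0 0 * (P 0 - c 0) ^ 2 + 2 * Q 0 1 * (P 0 - c 0) * (P 1 - c 1) +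
    Q 1 1 * (P 1 - c 1) ^ 2 - 1 with hγdef
  have hroot : α * t ^ 2 + 2 * β * t + γ = 0 := by
    rw [hαdef, hβdef, hγdef]
    linear_combination hpe
  obtain ⟨s, hs⟩ : ∃ s, α * s = -2 * β - α * t := ⟨(-2 * β - α * t) / α, by field_simp⟩
  have hroot' : α * s ^ 2 + 2 * β * s + γ = 0 := by
    linear_combination (s - t) * hs + hroot
  have heq := huniq !₂[P 0 + s * (R 0 - P 0), P 1 + s * (R 1 - P 1)]
    ⟨mem_lineThrough_iff.mpr ⟨s, by simp, by simp⟩, by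
      rw [mem_ellipseQ_iff hQs]
      simp only [Matrix.cons_val_zero, Matrix.cons_val_one]
      rw [hαdef, hβdef, hγdef] at hroot'
      linear_combination hroot'⟩
  have e0 : P 0 + s * (R 0 - P 0) = p 0 := by simp [← heq]
  have e1 : P 1 + s * (R 1 - P 1) = p 1 := by simp [← heq]
  have hst : s = t := by
    rcases hPR' with h | h
    · exact mul_right_cancel₀ h (by linarith)
    · exact mul_right_cancel₀ h (by linarith)
  subst hst
  change β ^ 2 - α * γ = 0
  have hβ : β = -α * s := by linarith
  rw [hβ] at hroot ⊢
  linear_combination -α * hroot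

lemma IsLine.eq_lineThrough {l : Set Pt} (hl : IsLine l) {P R : Pt} (hP : P ∈ l) (hR : R ∈ l)
    (hPR : P ≠ R) : l = lineThrough P R := by
  obtain ⟨A, B, -, rfl⟩ := hl
  exact congrArg _ (affineSpan_pair_eq_of_mem_of_mem_of_ne hP hR hPR).symm

lemma InnerProductGeometry.angle_eq_pi_div_four {V : Type*} [NormedAddCommGroup V]
    [InnerProductSpace ℝ V] {u v : V} (hu : u ≠ 0) (huv : inner ℝ u v = ‖u‖ ^ 2)
    (hv : ‖v‖ ^ 2 = 2 * ‖u‖ ^ 2) : InnerProductGeometry.angle u v = Real.pi / 4 := by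
  have hv' : ‖v‖ = √2 * ‖u‖ := by
    rw [← Real.sqrt_sq (norm_nonneg v), hv, Real.sqrt_mul (by norm_num),
      Real.sqrt_sq (norm_nonneg u)]
  have hu' := norm_pos_iff.mpr hu
  have h2 : √2 * √2 = (2 : ℝ) := Real.mul_self_sqrt (by norm_num)
  rw [InnerProductGeometry.angle, huv, hv', ← Real.arccos_cos (x := Real.pi / 4)
    (by positivity) (by linarith [Real.pi_pos]), Real.cos_pi_div_four]
  congr 1
  field_simp
  linarith

lemma ellipseE_gradient_pos {a b : ℝ} {M : Pt} (hM : M ∈ ellipseE a b) :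
    0 < (M 0 / a ^ 2) ^ 2 + (M 1 / b ^ 2) ^ 2 := by
  have hM' : M 0 ^ 2 / a ^ 2 + M 1 ^ 2 / b ^ 2 = 1 := hM
  by_contra! h
  have h0 : M 0 / a ^ 2 = 0 := by nlinarith [sq_nonneg (M 0 / a ^ 2), sq_nonneg (M 1 / b ^ 2)]
  have h1 : M 1 / b ^ 2 = 0 := by nlinarith [sq_nonneg (M 0 / a ^ 2), sq_nonneg (M 1 / b ^ 2)]
  have : M 0 * (M 0 / a ^ 2) + M 1 * (M 1 / b ^ 2) = 1 := by rw [← hM']; ring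
  simp [h0, h1] at this

lemma mem_ellipseE_of_chord {a b : ℝ} {M : Pt} (hM : M ∈ ellipseE a b) {w₀ w₁ : ℝ}
    {s : ℝ}
    (hs : s * (w₀ ^ 2 / a ^ 2 + w₁ ^ 2 / b ^ 2) = -2 * (M 0 / a ^ 2 * w₀ + M 1 / b ^ 2 * w₁)) :
    M + s • !₂[w₀, w₁] ∈ ellipseE a b := by
  have hM' : M 0 ^ 2 / a ^ 2 + M 1 ^ 2 / b ^ 2 = 1 := hM
  change (M + s • !₂[w₀, w₁]) 0 ^ 2 / a ^ 2 + (M + s • !₂[w₀, w₁]) 1 ^ 2 / b ^ 2 = 1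
  simp only [PiLp.add_apply, PiLp.smul_apply, Matrix.cons_val_zero,
    Matrix.cons_val_one, smul_eq_mul]
  linear_combination s * hs + hM'

lemma toLp_fin_two_ne_zero {x y : ℝ} (h : 0 < x ^ 2 + y ^ 2) : (!₂[x, y] : Pt) ≠ 0 := by
  intro h0
  have hx : x = 0 := by simpa using congrArg (fun p : Pt => p 0) h0
  have hy : y = 0 := by simpa using congrArg (fun p : Pt => p 1) h0
  simp [hx, hy] at h

lemma angle_add_smul_eq_pi_div_four (M : Pt) {u₀ u₁ v₀ v₁ s r : ℝ} (hs : 0 < s) (hr : 0 < r)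
    (hu : 0 < u₀ ^ 2 + u₁ ^ 2) (huv : u₀ * v₀ + u₁ * v₁ = u₀ ^ 2 + u₁ ^ 2)
    (hv : v₀ ^ 2 + v₁ ^ 2 = 2 * (u₀ ^ 2 + u₁ ^ 2)) :
    EuclideanGeometry.angle (M + s • !₂[u₀, u₁]) M (M + r • !₂[v₀, v₁]) = Real.pi / 4 := by
  simp only [EuclideanGeometry.angle, vsub_eq_sub, add_sub_cancel_left]
  rw [InnerProductGeometry.angle_smul_left_of_pos _ _ hs,
    InnerProductGeometry.angle_smul_right_of_pos _ _ hr]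
  refine InnerProductGeometry.angle_eq_pi_div_four (toLp_fin_two_ne_zero hu) ?_ ?_
  · simp [EuclideanSpace.real_norm_sq_eq, PiLp.inner_apply, Fin.sum_univ_two]
    linarith
  · simp [EuclideanSpace.real_norm_sq_eq, Fin.sum_univ_two]
    linarith

lemma tangencyDisc_chord_eq_zero {a b : ℝ} {M : Pt} (hM : M ∈ ellipseE a b)
    {c : Pt} {Q : Matrix (Fin 2) (Fin 2) ℝ} (hQs : Q.IsSymm) (hQp : Q.PosDef)
    (hEnv : ∀ N L : Pt, N ∈ ellipseE a b → L ∈ ellipseE a b →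
      M ≠ N → M ≠ L → N ≠ L → EuclideanGeometry.angle N M L = Real.pi / 4 →
      IsTangentTo (lineThrough N L) (ellipseQ c Q))
    {u₀ u₁ v₀ v₁ s r : ℝ} (hs : 0 < s) (hr : 0 < r)
    (hu : 0 < u₀ ^ 2 + u₁ ^ 2) (huv : u₀ * v₀ + u₁ * v₁ = u₀ ^ 2 + u₁ ^ 2)
    (hv : v₀ ^ 2 + v₁ ^ 2 = 2 * (u₀ ^ 2 + u₁ ^ 2))
    (hsu : s * (u₀ ^ 2 / a ^ 2 + u₁ ^ 2 / b ^ 2) = -2 * (M 0 / a ^ 2 * u₀ + M 1 / b ^ 2 * u₁))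
    (hrv : r * (v₀ ^ 2 / a ^ 2 + v₁ ^ 2 / b ^ 2) = -2 * (M 0 / a ^ 2 * v₀ + M 1 / b ^ 2 * v₁)) :
    tangencyDisc (Q 0 0) (Q 0 1) (Q 1 1) (M 0 + s * u₀ - c 0) (M 1 + s * u₁ - c 1)
      (M 0 + r * v₀ - (M 0 + s * u₀)) (M 1 + r * v₁ - (M 1 + s * u₁)) = 0 := by
  have hu_ne := toLp_fin_two_ne_zero hu
  have hv_ne := toLp_fin_two_ne_zero (x := v₀) (y := v₁) (by rw [hv]; positivity)
  have hNL := angle_add_smul_eq_pi_div_four M hs hr hu huv hv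
  have hne : M + s • !₂[u₀, u₁] ≠ M + r • !₂[v₀, v₁] := by
    intro h
    rw [h, EuclideanGeometry.angle_self_of_ne (by simp [hr.ne', hv_ne])] at hNL
    linarith [Real.pi_pos]
  have h := tangencyDisc_eq_zero hQs hQp hne (hEnv _ _ (mem_ellipseE_of_chord hM hsu)
    (mem_ellipseE_of_chord hM hrv) (by simp [hs.ne', hu_ne]) (by simp [hr.ne', hv_ne]) hne hNL)
  simpa using h

lemma tangencyDisc_eq_zero_of_chords {a b : ℝ} (ha : 0 < a) (hb : 0 < b)
    {M : Pt} (hM : M ∈ ellipseE a b)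
    {c : Pt} {Q : Matrix (Fin 2) (Fin 2) ℝ} (hQs : Q.IsSymm) (hQp : Q.PosDef)
    (hEnv : ∀ N L : Pt, N ∈ ellipseE a b → L ∈ ellipseE a b →
      M ≠ N → M ≠ L → N ≠ L → EuclideanGeometry.angle N M L = Real.pi / 4 →
      IsTangentTo (lineThrough N L) (ellipseQ c Q))
    {g₀ g₁ σ : ℝ} (hg₀ : g₀ = M 0 / a ^ 2) (hg₁ : g₁ = M 1 / b ^ 2) (hσ : σ ^ 2 = 1) :
    tangencyDisc (Q 0 0) (Q 0 1) (Q 1 1) (M 0 - c 0) (M 1 - c 1)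
      (-σ * g₁ - g₀) (σ * g₀ - g₁) = 0 := by
  have hG : 0 < g₀ ^ 2 + g₁ ^ 2 := by
    rw [hg₀, hg₁]
    exact ellipseE_gradient_pos hM
  set G := g₀ ^ 2 + g₁ ^ 2 with hGdef
  have hpos : ∀ x y : ℝ, 0 < x ^ 2 + y ^ 2 → 0 < x ^ 2 / a ^ 2 + y ^ 2 / b ^ 2 := by
    intro x y h
    by_cases hx : x = 0
    · have : y ≠ 0 := by rintro rfl; simp [hx] at h
      positivity
    · positivity
  -- the directions of the two sides of the angle, and the parameters of the endpoints on them
  let u₀ : ℝ → ℝ := fun ε => -σ * g₁ - ε * g₀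
  let u₁ : ℝ → ℝ := fun ε => σ * g₀ - ε * g₁
  let v₀ : ℝ → ℝ := fun ε => -(1 - ε) * σ * g₁ - (1 + ε) * g₀
  let v₁ : ℝ → ℝ := fun ε => (1 - ε) * σ * g₀ - (1 + ε) * g₁
  have hu : ∀ ε, u₀ ε ^ 2 + u₁ ε ^ 2 = (1 + ε ^ 2) * G := fun ε => by
    simp only [u₀, u₁, hGdef]
    linear_combination (g₀ ^ 2 + g₁ ^ 2) * hσ
  have hv : ∀ ε, v₀ ε ^ 2 + v₁ ε ^ 2 = 2 * ((1 + ε ^ 2) * G) := fun ε => by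
    simp only [v₀, v₁, hGdef]
    linear_combination (1 - ε) ^ 2 * (g₀ ^ 2 + g₁ ^ 2) * hσ
  have huv : ∀ ε, u₀ ε * v₀ ε + u₁ ε * v₁ ε = (1 + ε ^ 2) * G := fun ε => by
    simp only [u₀, u₁, v₀, v₁, hGdef]
    linear_combination (1 - ε) * (g₀ ^ 2 + g₁ ^ 2) * hσ
  have hqu : ∀ ε, 0 < u₀ ε ^ 2 / a ^ 2 + u₁ ε ^ 2 / b ^ 2 := fun ε =>
    hpos _ _ (by rw [hu]; positivity)
  have hqv : ∀ ε, 0 < v₀ ε ^ 2 / a ^ 2 + v₁ ε ^ 2 / b ^ 2 := fun ε =>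
    hpos _ _ (by rw [hv]; positivity)
  let s : ℝ → ℝ := fun ε => 2 * ε * G / (u₀ ε ^ 2 / a ^ 2 + u₁ ε ^ 2 / b ^ 2)
  let r : ℝ → ℝ := fun ε => 2 * (1 + ε) * G / (v₀ ε ^ 2 / a ^ 2 + v₁ ε ^ 2 / b ^ 2)
  let F : ℝ → ℝ := fun ε => tangencyDisc (Q 0 0) (Q 0 1) (Q 1 1)
    (M 0 + s ε * u₀ ε - c 0) (M 1 + s ε * u₁ ε - c 1)
    (M 0 + r ε * v₀ ε - (M 0 + s ε * u₀ ε)) (M 1 + r ε * v₁ ε - (M 1 + s ε * u₁ ε))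
  have hcu₀ : Continuous u₀ := by fun_prop
  have hcu₁ : Continuous u₁ := by fun_prop
  have hcv₀ : Continuous v₀ := by fun_prop
  have hcv₁ : Continuous v₁ := by fun_prop
  have hcs : Continuous s :=
    Continuous.div₀ (by fun_prop) (by fun_prop) fun ε => (hqu ε).ne'
  have hcr : Continuous r :=
    Continuous.div₀ (by fun_prop) (by fun_prop) fun ε => (hqv ε).ne'
  have hcF : Continuous F := by
    simp only [F, tangencyDisc]
    fun_prop
  have hF : ∀ ε, 0 < ε → F ε = 0 := by
    intro ε hε
    simp only [F]
    refine tangencyDisc_chord_eq_zero hM hQs hQp hEnv (div_pos (by positivity) (hqu ε))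
      (div_pos (by positivity) (hqv ε)) (by rw [hu]; positivity) (by rw [huv, hu])
      (by rw [hv, hu]) ?_ ?_
    · rw [div_mul_cancel₀ _ (hqu ε).ne', ← hg₀, ← hg₁]
      simp only [u₀, u₁, hGdef]
      ring
    · rw [div_mul_cancel₀ _ (hqv ε).ne', ← hg₀, ← hg₁]
      simp only [v₀, v₁, hGdef]
      ring
  have hF0 : F 0 = 0 := by
    have h1 : Filter.Tendsto F (nhdsWithin 0 (Set.Ioi 0)) (nhds (F 0)) :=
      hcF.continuousAt.tendsto.mono_left nhdsWithin_le_nhds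
    refine tendsto_nhds_unique (h1.congr' ?_) tendsto_const_nhds
    filter_upwards [self_mem_nhdsWithin] with ε hε using hF ε hε
  have hr : r 0 ≠ 0 := (div_pos (by positivity) (hqv 0)).ne'
  have hs : s 0 = 0 := by simp [s]
  have hv₀ : v₀ 0 = -σ * g₁ - g₀ := by simp [v₀]
  have hv₁ : v₁ 0 = σ * g₀ - g₁ := by simp [v₁]
  refine (mul_eq_zero.mp (Eq.trans ?_ hF0)).resolve_left (pow_ne_zero 2 hr)
  simp only [F, hs, hv₀, hv₁, tangencyDisc]
  ring

/-- A nonzero binary quadratic form with trace zero vanishes on perpendicular lines only. -/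
lemma dot_eq_zero_of_traceless {A B x y z w : ℝ} (hAB : A ≠ 0 ∨ B ≠ 0)
    (h₁ : A * (x ^ 2 - y ^ 2) + B * (x * y) = 0) (h₂ : A * (z ^ 2 - w ^ 2) + B * (z * w) = 0)
    (hdet : x * w - y * z ≠ 0) : x * z + y * w = 0 := by
  have h : (x * w - y * z) * (x * z + y * w) = 0 := by
    rcases hAB with h | h
    · refine (mul_eq_zero.mp ?_).resolve_left h
      linear_combination (z * w) * h₁ - (x * y) * h₂
    · refine (mul_eq_zero.mp ?_).resolve_left h
      linear_combination -(z ^ 2 - w ^ 2) * h₁ + (x ^ 2 - y ^ 2) * h₂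
  exact (mul_eq_zero.mp h).resolve_left hdet

/-- **Orthoptic property.** For `θ = π/4`, the point `M` sees its Frégier ellipse
`E(c,Q)` under a right angle: the two tangent lines from `M`, touching at `T₁`, `T₂`,
satisfy `∠T₁MT₂ = π/2`, i.e. `M` lies on the orthoptic circle of `E(c,Q)`. -/
theorem fregier_orthoptic (a b : ℝ) (ha : 0 < a) (hb : 0 < b)
    (M : Pt) (hM : M ∈ ellipseE a b)
    (c : Pt) (Q : Matrix (Fin 2) (Fin 2) ℝ) (hQs : Q.IsSymm) (hQp : Q.PosDef)
    (hEnv : ∀ N L : Pt, N ∈ ellipseE a b → L ∈ ellipseE a b →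
      M ≠ N → M ≠ L → N ≠ L → EuclideanGeometry.angle N M L = Real.pi / 4 →
      IsTangentTo (lineThrough N L) (ellipseQ c Q))
    (l₁ l₂ : Set Pt) (hl₁ : IsLine l₁) (hl₂ : IsLine l₂) (hll : l₁ ≠ l₂)
    (hMl₁ : M ∈ l₁) (hMl₂ : M ∈ l₂)
    (T₁ T₂ : Pt)
    (htan₁ : l₁ ∩ ellipseQ c Q = {T₁}) (htan₂ : l₂ ∩ ellipseQ c Q = {T₂}) :
    EuclideanGeometry.angle T₁ M T₂ = Real.pi / 2 := by
  rw [EuclideanGeometry.angle, ← InnerProductGeometry.inner_eq_zero_iff_angle_eq_pi_div_two]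
  by_cases hT₁ : M = T₁
  · simp [hT₁]
  by_cases hT₂ : M = T₂
  · simp [hT₂]
  have hm₁ : T₁ ∈ l₁ ∩ ellipseQ c Q := htan₁ ▸ rfl
  have hm₂ : T₂ ∈ l₂ ∩ ellipseQ c Q := htan₂ ▸ rfl
  have hL₁ := hl₁.eq_lineThrough hMl₁ hm₁.1 hT₁
  have hL₂ := hl₂.eq_lineThrough hMl₂ hm₂.1 hT₂
  have hTT : T₂ ∉ l₁ := by
    intro h
    exact hll ((hl₁.eq_lineThrough hMl₁ h hT₂).trans hL₂.symm)
  have hdisc₁ := tangencyDisc_eq_zero hQs hQp hT₁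
    ⟨T₁, hL₁ ▸ hm₁, fun p hp => by rw [← hL₁, htan₁] at hp; exact hp⟩
  have hdisc₂ := tangencyDisc_eq_zero hQs hQp hT₂
    ⟨T₂, hL₂ ▸ hm₂, fun p hp => by rw [← hL₂, htan₂] at hp; exact hp⟩
  have hdet : (T₁ 0 - M 0) * (T₂ 1 - M 1) - (T₁ 1 - M 1) * (T₂ 0 - M 0) ≠ 0 := by
    intro h
    apply hTT
    rw [hL₁, mem_lineThrough_iff]
    rcases Pt.ne_iff.mp hT₁ with h0 | h0
    · exact ⟨(T₂ 0 - M 0) / (T₁ 0 - M 0), by field_simp; ring, by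
        field_simp; linear_combination h⟩
    · exact ⟨(T₂ 1 - M 1) / (T₁ 1 - M 1), by field_simp; linear_combination -h, by
        field_simp; ring⟩
  have hp := tangencyDisc_eq_zero_of_chords ha hb hM hQs hQp hEnv rfl rfl (σ := 1) (by norm_num)
  have hn := tangencyDisc_eq_zero_of_chords ha hb hM hQs hQp hEnv rfl rfl (σ := -1) (by norm_num)
  have hG := (ellipseE_gradient_pos hM).ne'
  have hpos : ∀ {x y : ℝ}, x ≠ 0 ∨ y ≠ 0 → _ := posDef_fin_two_form_pos hQs hQp
  simp only [PiLp.inner_apply, Fin.sum_univ_two, vsub_eq_sub, PiLp.sub_apply, RCLike.inner_apply,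
    conj_trivial]
  rw [mul_comm (T₂ 0 - M 0), mul_comm (T₂ 1 - M 1)]
  generalize M 0 / a ^ 2 = g₀, M 1 / b ^ 2 = g₁ at hp hn hG
  generalize M 0 - c 0 = d₀, M 1 - c 1 = d₁ at *
  generalize T₁ 0 - M 0 = x, T₁ 1 - M 1 = y, T₂ 0 - M 0 = z, T₂ 1 - M 1 = w at *
  generalize Q 0 0 = q₀, Q 0 1 = q₁, Q 1 1 = q₂ at *
  unfold tangencyDisc at *
  -- the discriminant is the form `A * w₀ ^ 2 + B * w₀ * w₁ + C * w₁ ^ 2`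
  obtain ⟨A, hA⟩ : ∃ A, A = (q₀ * d₀ + q₁ * d₁) ^ 2 -
    q₀ * (q₀ * d₀ ^ 2 + 2 * q₁ * d₀ * d₁ + q₂ * d₁ ^ 2 - 1) := ⟨_, rfl⟩
  obtain ⟨B, hB⟩ : ∃ B, B = 2 * (q₀ * d₀ + q₁ * d₁) * (q₁ * d₀ + q₂ * d₁) -
    2 * q₁ * (q₀ * d₀ ^ 2 + 2 * q₁ * d₀ * d₁ + q₂ * d₁ ^ 2 - 1) := ⟨_, rfl⟩
  obtain ⟨C, hC⟩ : ∃ C, C = (q₁ * d₀ + q₂ * d₁) ^ 2 -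
    q₂ * (q₀ * d₀ ^ 2 + 2 * q₁ * d₀ * d₁ + q₂ * d₁ ^ 2 - 1) := ⟨_, rfl⟩
  have htr : C = -A := by
    have : (2 * (g₀ ^ 2 + g₁ ^ 2)) * (A + C) = 0 := by
      rw [hA, hC]
      linear_combination hp + hn
    have := (mul_eq_zero.mp this).resolve_left (mul_ne_zero two_ne_zero hG)
    linarith
  have hAB : A ≠ 0 ∨ B ≠ 0 := by
    by_contra! h
    obtain ⟨hA0, hB0⟩ := h
    have hC0 : C = 0 := by rw [htr, hA0, neg_zero]
    have hd : q₀ * d₀ ^ 2 + 2 * q₁ * d₀ * d₁ + q₂ * d₁ ^ 2 = 0 := by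
      rw [hA] at hA0
      rw [hB] at hB0
      rw [hC] at hC0
      linear_combination d₀ ^ 2 * hA0 + d₀ * d₁ * hB0 + d₁ ^ 2 * hC0
    have hd0 : d₀ = 0 ∧ d₁ = 0 := by
      by_contra h
      exact (hpos (not_and_or.mp h)).ne' hd
    have hq := hpos (x := 1) (y := 0) (by simp)
    rw [hA, hd0.1, hd0.2] at hA0
    nlinarith
  refine dot_eq_zero_of_traceless hAB ?_ ?_ hdet
  · rw [show A * (x ^ 2 - y ^ 2) + B * (x * y) = A * x ^ 2 + B * (x * y) + C * y ^ 2 by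
      rw [htr]; ring, hA, hB, hC]
    linear_combination hdisc₁
  · rw [show A * (z ^ 2 - w ^ 2) + B * (z * w) = A * z ^ 2 + B * (z * w) + C * w ^ 2 by
      rw [htr]; ring, hA, hB, hC]
    linear_combination hdisc₂
end
end
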